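/- Let p, q > 0, let x, y > 0 and let a, b be real numbers with x − a > 0, x + a > 0, y − b > 0 and y + b > 0. Then the extended (p,q)-beta function satisfies B_{p,q}(x, y)² ≤ B_{p,q}(x + a, y + b) · B_{p,q}(x − a, y − b). -/

import Mathlib

/-- The extended `(p,q)`-beta function
`B_{p,q}(x,y) = ∫₀¹ t^(x-1) (1-t)^(y-1) exp(-p/t - q/(1-t)) dt`. -/
noncomputable def extBeta (p q x y : ℝ) : ℝ :=
  ∫ t in (0:ℝ)..1, t ^ (x - 1) * (1 - t) ^ (y - 1) * Real.exp (-p / t - q / (1 - t))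

open MeasureTheory

/-- A Cauchy–Schwarz inequality for integrals, with a pointwise hypothesis. -/
theorem sq_integral_le_integral_mul_integral {α : Type*} [MeasurableSpace α] {μ : Measure α}
    {f g h : α → ℝ} (hf : Integrable f μ) (hg : Integrable g μ) (hh : Integrable h μ)
    (hf0 : 0 ≤ᵐ[μ] f) (hg0 : 0 ≤ᵐ[μ] g) (hle : ∀ᵐ t ∂μ, h t ^ 2 ≤ f t * g t) :
    (∫ t, h t ∂μ) ^ 2 ≤ (∫ t, f t ∂μ) * ∫ t, g t ∂μ := by
  have hquad (s : ℝ) :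
      0 ≤ (∫ t, f t ∂μ) * (s * s) + (-2 * ∫ t, h t ∂μ) * s + ∫ t, g t ∂μ := by
    have hint : ∫ t, (f t * (s * s) - h t * (2 * s) + g t) ∂μ
        = (∫ t, f t ∂μ) * (s * s) - (∫ t, h t ∂μ) * (2 * s) + ∫ t, g t ∂μ := by
      have hfs := hf.mul_const (s * s)
      have hhs := hh.mul_const (2 * s)
      rw [integral_add (f := fun t ↦ f t * (s * s) - h t * (2 * s)) (hfs.sub hhs) hg,
        integral_sub hfs hhs, integral_mul_const, integral_mul_const]
    have hnonneg : 0 ≤ ∫ t, (f t * (s * s) - h t * (2 * s) + g t) ∂μ := by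
      refine integral_nonneg_of_ae ?_
      filter_upwards [hf0, hg0, hle] with t hft hgt ht
      simp only [Pi.zero_apply] at hft hgt ⊢
      have hsq : (h t * (2 * s)) ^ 2 ≤ (f t * (s * s) + g t) ^ 2 := by
        nlinarith [mul_le_mul_of_nonneg_right ht (sq_nonneg s),
          sq_nonneg (f t * (s * s) - g t)]
      have hsum := add_nonneg (mul_nonneg hft (mul_self_nonneg s)) hgt
      linarith [le_of_abs_le (abs_le_of_sq_le_sq hsq hsum)]
    linarith
  have hd := discrim_le_zero hquad
  rw [discrim] at hd
  linarith

theorem intervalIntegrable_rpow_mul_one_sub_rpow {x y : ℝ} (hx : 0 < x) (hy : 0 < y) :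
    IntervalIntegrable (fun t : ℝ ↦ t ^ (x - 1) * (1 - t) ^ (y - 1)) volume 0 1 := by
  have h := (Complex.betaIntegral_convergent (u := x) (v := y) (by simpa) (by simpa)).norm
  refine h.congr_uIoo fun t ht ↦ ?_
  rw [Set.uIoo_of_le zero_le_one] at ht
  have h1 : 0 < 1 - t := sub_pos.2 ht.2
  have h1' : (1 - t : ℂ) = ((1 - t : ℝ) : ℂ) := by push_cast; rfl
  simp only [norm_mul, h1', Complex.norm_cpow_eq_rpow_re_of_pos ht.1,
    Complex.norm_cpow_eq_rpow_re_of_pos h1, Complex.sub_re, Complex.ofReal_re, Complex.one_re]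

theorem integrableOn_extBeta_integrand {p q x y : ℝ} (hp : 0 ≤ p) (hq : 0 ≤ q)
    (hx : 0 < x) (hy : 0 < y) :
    IntegrableOn (fun t : ℝ ↦ t ^ (x - 1) * (1 - t) ^ (y - 1) * Real.exp (-p / t - q / (1 - t)))
      (Set.Ioo 0 1) := by
  have h := (intervalIntegrable_iff_integrableOn_Ioo_of_le zero_le_one).1
    (intervalIntegrable_rpow_mul_one_sub_rpow hx hy)
  refine Integrable.mono' h (Measurable.aestronglyMeasurable (by fun_prop)) ?_
  filter_upwards [ae_restrict_mem measurableSet_Ioo] with t ht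
  have h0 : 0 < t := ht.1
  have h1 : 0 < 1 - t := sub_pos.2 ht.2
  rw [Real.norm_of_nonneg (by positivity)]
  refine mul_le_of_le_one_right (by positivity) (Real.exp_le_one_iff.2 ?_)
  have hpt : 0 ≤ p / t := by positivity
  have hqt : 0 ≤ q / (1 - t) := by positivity
  rw [neg_div]
  linarith

theorem extBeta_eq_setIntegral_Ioo (p q x y : ℝ) :
    extBeta p q x y = ∫ t in Set.Ioo (0 : ℝ) 1,
      t ^ (x - 1) * (1 - t) ^ (y - 1) * Real.exp (-p / t - q / (1 - t)) := by
  rw [extBeta, intervalIntegral.integral_of_le zero_le_one, integral_Ioc_eq_integral_Ioo]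

theorem extBeta_sq_le_shift (p q x y a b : ℝ) (hp : 0 < p) (hq : 0 < q)
    (hx : 0 < x) (hy : 0 < y)
    (hxa : 0 < x - a) (hxa' : 0 < x + a) (hyb : 0 < y - b) (hyb' : 0 < y + b) :
    extBeta p q x y ^ 2 ≤ extBeta p q (x + a) (y + b) * extBeta p q (x - a) (y - b) := by
  have hnonneg (u v : ℝ) : 0 ≤ᵐ[volume.restrict (Set.Ioo (0 : ℝ) 1)] fun t : ℝ ↦
      t ^ (u - 1) * (1 - t) ^ (v - 1) * Real.exp (-p / t - q / (1 - t)) := by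
    filter_upwards [ae_restrict_mem measurableSet_Ioo] with t ht
    have h0 : 0 < t := ht.1
    have h1 : 0 < 1 - t := sub_pos.2 ht.2
    simp only [Pi.zero_apply]
    positivity
  have hshift {t : ℝ} (ht : 0 < t) (u c : ℝ) :
      t ^ (u + c - 1) * t ^ (u - c - 1) = (t ^ (u - 1)) ^ 2 := by
    rw [sq, ← Real.rpow_add ht, ← Real.rpow_add ht]
    ring_nf
  simp only [extBeta_eq_setIntegral_Ioo]
  refine sq_integral_le_integral_mul_integral
    (integrableOn_extBeta_integrand hp.le hq.le hxa' hyb')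
    (integrableOn_extBeta_integrand hp.le hq.le hxa hyb)
    (integrableOn_extBeta_integrand hp.le hq.le hx hy) (hnonneg _ _) (hnonneg _ _) ?_
  filter_upwards [ae_restrict_mem measurableSet_Ioo] with t ht
  refine le_of_eq ?_
  rw [mul_pow, mul_pow, ← hshift ht.1 x a, ← hshift (sub_pos.2 ht.2) y b]
  ring
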